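/- arXiv:2009.08526 — 3 statements merged into one kernel-verified Lean document; each statement's English description precedes it below -/
import Mathlib

section
/- Let k be a field, let R = k[x₁,…,x_r] be a polynomial ring over k, and let S be a commutative R-algebra that is free of finite positive rank as an R-module. Let B be a finitely generated R-module and let j ≥ 1 be an integer. Then B ⊗_R S is a j-th syzygy over S if and only if B is a j-th syzygy over R. -/
open TensorProduct

/-- A finitely generated module `M` over a commutative ring `R` is a `j`-th syzygy
(`j ≥ 1`) if there is an exact sequence `0 → M → F₁ → ⋯ → F_j` of `R`-modules in which
each `F_k` is a finitely generated free `R`-module (which we may take to be `R^{n k}`). -/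
def IsSyzygyOfOrder (R : Type*) [CommRing R] (M : Type*) [AddCommGroup M] [Module R M]
    (j : ℕ) : Prop :=
  ∃ (n : ℕ → ℕ) (g : M →ₗ[R] (Fin (n 0) → R))
    (f : ∀ i : ℕ, (Fin (n i) → R) →ₗ[R] (Fin (n (i + 1)) → R)),
    Function.Injective g ∧
    (2 ≤ j → Function.Exact g (f 0)) ∧
    ∀ i : ℕ, i + 3 ≤ j → Function.Exact (f i) (f (i + 1))

section WeaklyRegular

open RingTheory.Sequence

variable {R : Type*} [CommRing R]
variable {M F N : Type*} [AddCommGroup M] [Module R M] [AddCommGroup F] [Module R F]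
  [AddCommGroup N] [Module R N]

lemma LinearMap.map_mem_smul_top (f : M →ₗ[R] F) {I : Ideal R} {m : M}
    (hm : m ∈ I • (⊤ : Submodule R M)) : f m ∈ I • (⊤ : Submodule R F) := by
  have h := Submodule.mem_map_of_mem (f := f) hm
  rw [Submodule.map_smul''] at h
  exact (smul_mono_right I le_top : _ ≤ I • (⊤ : Submodule R F)) h

lemma LinearMap.exists_of_map_mem_smul_top {f : F →ₗ[R] N} (hf : Function.Surjective f)
    {I : Ideal R} {x : F} (hx : f x ∈ I • (⊤ : Submodule R N)) :
    ∃ y ∈ I • (⊤ : Submodule R F), f y = f x := by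
  rw [← LinearMap.range_eq_top.mpr hf, ← Submodule.map_top, ← Submodule.map_smul''] at hx
  exact hx

lemma isWeaklyRegular_concat_iff (xs : List R) (x : R) :
    IsWeaklyRegular M (xs ++ [x]) ↔ IsWeaklyRegular M xs ∧
      ∀ m : M, x • m ∈ Ideal.ofList xs • (⊤ : Submodule R M) →
        m ∈ Ideal.ofList xs • (⊤ : Submodule R M) := by
  rw [isWeaklyRegular_append_iff, isWeaklyRegular_singleton_iff,
    isSMulRegular_quotient_iff_mem_of_smul_mem]

lemma mem_ofList_concat_smul_top_iff (xs : List R) (x : R) (m : M) :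
    m ∈ Ideal.ofList (xs ++ [x]) • (⊤ : Submodule R M) ↔
      ∃ y : M, m - x • y ∈ Ideal.ofList xs • (⊤ : Submodule R M) := by
  rw [Ideal.ofList_append, Ideal.ofList_singleton, Submodule.sup_smul,
    Submodule.ideal_span_singleton_smul, Submodule.mem_sup]
  constructor
  · rintro ⟨a, ha, b, hb, rfl⟩
    obtain ⟨y, -, rfl⟩ := hb
    exact ⟨y, by simpa using ha⟩
  · rintro ⟨y, hy⟩
    exact ⟨_, hy, x • y, Submodule.smul_mem_pointwise_smul _ _ _ trivial, by simp⟩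

lemma isWeaklyRegular_of_retract (i : M →ₗ[R] F) (p : F →ₗ[R] M) (h : ∀ m, p (i m) = m)
    {xs : List R} (hF : IsWeaklyRegular F xs) : IsWeaklyRegular M xs := by
  induction xs using List.reverseRecOn with
  | nil => exact .nil R M
  | append_singleton xs x ih =>
    rw [isWeaklyRegular_concat_iff] at hF ⊢
    refine ⟨ih hF.1, fun m hm ↦ ?_⟩
    rw [← h m]
    exact p.map_mem_smul_top (hF.2 _ (by simpa using i.map_mem_smul_top hm))

lemma isWeaklyRegular_of_flat [Module.Flat R M] {xs : List R} (h : IsWeaklyRegular R xs) :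
    IsWeaklyRegular M xs :=
  ((TensorProduct.rid R M).isWeaklyRegular_congr xs).mp h.isWeaklyRegular_lTensor

variable {g : M →ₗ[R] F} {f : F →ₗ[R] N}

lemma mem_smul_top_of_exact (hg : Function.Injective g) (hgf : Function.Exact g f)
    (hf : Function.Surjective f) {xs : List R} (hN : IsWeaklyRegular N xs) {m : M}
    (hm : g m ∈ Ideal.ofList xs • (⊤ : Submodule R F)) :
    m ∈ Ideal.ofList xs • (⊤ : Submodule R M) := by
  induction xs using List.reverseRecOn generalizing m with
  | nil => simpa [map_eq_zero_iff g hg] using hm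
  | append_singleton xs x ih =>
    rw [isWeaklyRegular_concat_iff] at hN
    rw [mem_ofList_concat_smul_top_iff] at hm ⊢
    obtain ⟨y, hy⟩ := hm
    have hfy : f y ∈ Ideal.ofList xs • (⊤ : Submodule R N) := by
      refine hN.2 _ ?_
      have h := f.map_mem_smul_top hy
      rw [map_sub, hgf.apply_apply_eq_zero, zero_sub, map_smul] at h
      exact neg_mem_iff.mp h
    obtain ⟨z, hz, hzy⟩ := f.exists_of_map_mem_smul_top hf hfy
    obtain ⟨m', hm'⟩ := (hgf (y - z)).mp (by rw [map_sub, hzy, sub_self])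
    refine ⟨m', ih hN.1 ?_⟩
    have h : g (m - x • m') = (g m - x • y) + x • z := by
      rw [map_sub, map_smul, hm', smul_sub]
      abel
    rw [h]
    exact add_mem hy (Submodule.smul_mem _ _ hz)

lemma isWeaklyRegular_concat_of_exact (hg : Function.Injective g) (hgf : Function.Exact g f)
    (hf : Function.Surjective f) {xs : List R} {x : R} (hM : IsWeaklyRegular M xs)
    (hF : IsWeaklyRegular F (xs ++ [x])) (hN : IsWeaklyRegular N xs) :
    IsWeaklyRegular M (xs ++ [x]) := by
  rw [isWeaklyRegular_concat_iff] at hF ⊢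
  refine ⟨hM, fun m hm ↦ mem_smul_top_of_exact hg hgf hf hN (hF.2 _ ?_)⟩
  simpa using g.map_mem_smul_top hm

lemma isWeaklyRegular_of_exact (hg : Function.Injective g) (hgf : Function.Exact g f)
    (hf : Function.Surjective f) {xs : List R} (hF : IsWeaklyRegular F xs)
    (hN : IsWeaklyRegular N xs) : IsWeaklyRegular M xs := by
  induction xs using List.reverseRecOn with
  | nil => exact .nil R M
  | append_singleton xs x ih =>
    have hN' := ((isWeaklyRegular_concat_iff _ _).mp hN).1
    exact isWeaklyRegular_concat_of_exact hg hgf hf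
      (ih ((isWeaklyRegular_concat_iff _ _).mp hF).1 hN') hF hN'

lemma isWeaklyRegular_cokernel (hgf : Function.Exact g f) (hf : Function.Surjective f)
    {xs : List R} (hF : IsWeaklyRegular F xs)
    (h : ∀ ys, ys <+: xs → ∀ m : M, g m ∈ Ideal.ofList ys • (⊤ : Submodule R F) →
      m ∈ Ideal.ofList ys • (⊤ : Submodule R M)) : IsWeaklyRegular N xs := by
  induction xs using List.reverseRecOn with
  | nil => exact .nil R N
  | append_singleton xs x ih =>
    rw [isWeaklyRegular_concat_iff] at hF ⊢
    refine ⟨ih hF.1 fun ys hys ↦ h ys (hys.trans (List.prefix_append _ _)), fun n hn ↦ ?_⟩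
    obtain ⟨y, rfl⟩ := hf n
    rw [← map_smul] at hn
    obtain ⟨z, hz, hzy⟩ := f.exists_of_map_mem_smul_top hf hn
    obtain ⟨m, hm⟩ := (hgf (x • y - z)).mp (by rw [map_sub, hzy, sub_self])
    have hgm : g m ∈ Ideal.ofList (xs ++ [x]) • (⊤ : Submodule R F) := by
      rw [mem_ofList_concat_smul_top_iff]
      exact ⟨y, by simpa [hm] using hz⟩
    obtain ⟨m', hm'⟩ :=
      (mem_ofList_concat_smul_top_iff _ _ _).mp (h _ (List.prefix_refl _) m hgm)
    have hy : y - g m' ∈ Ideal.ofList xs • (⊤ : Submodule R F) := by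
      refine hF.2 _ ?_
      have e : x • (y - g m') = g (m - x • m') + z := by
        rw [map_sub, map_smul, hm, smul_sub]
        abel
      rw [e]
      exact add_mem (g.map_mem_smul_top hm') hz
    simpa [hgf.apply_apply_eq_zero] using f.map_mem_smul_top hy

end WeaklyRegular

/-- Every weakly `R`-regular sequence of length at most `j` is weakly `M`-regular. -/
def IsRegularUpTo (R : Type*) [CommRing R] (M : Type*) [AddCommGroup M] [Module R M]
    (j : ℕ) : Prop :=
  ∀ xs : List R, xs.length ≤ j → RingTheory.Sequence.IsWeaklyRegular R xs →
    RingTheory.Sequence.IsWeaklyRegular M xs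

lemma IsRegularUpTo.of_retract {R M F : Type*} [CommRing R] [AddCommGroup M] [Module R M]
    [AddCommGroup F] [Module R F] (i : M →ₗ[R] F) (p : F →ₗ[R] M) (h : ∀ m, p (i m) = m) {j : ℕ}
    (hF : IsRegularUpTo R F j) : IsRegularUpTo R M j :=
  fun xs hxs hR ↦ isWeaklyRegular_of_retract i p h (hF xs hxs hR)

lemma IsRegularUpTo.succ_of_exact {R M F N : Type*} [CommRing R] [AddCommGroup M] [Module R M]
    [AddCommGroup F] [Module R F] [Module.Flat R F] [AddCommGroup N] [Module R N]
    {g : M →ₗ[R] F} {f : F →ₗ[R] N} (hg : Function.Injective g) (hgf : Function.Exact g f)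
    (hf : Function.Surjective f) {j : ℕ} (hN : IsRegularUpTo R N j) :
    IsRegularUpTo R M (j + 1) := by
  intro xs hxs hR
  cases xs using List.reverseRecOn with
  | nil => exact .nil R M
  | append_singleton xs x =>
    have hxs' : xs.length ≤ j := by simpa using hxs
    have hR' := ((isWeaklyRegular_concat_iff _ _).mp hR).1
    have hN' := hN xs hxs' hR'
    exact isWeaklyRegular_concat_of_exact hg hgf hf
      (isWeaklyRegular_of_exact hg hgf hf (isWeaklyRegular_of_flat hR') hN')
      (isWeaklyRegular_of_flat hR) hN'

section Syzygy

universe v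

variable {R : Type*} [CommRing R]

lemma IsSyzygyOfOrder.exists_cokernel {M : Type*} [AddCommGroup M] [Module R M] {j : ℕ}
    (hj : 1 ≤ j) (h : IsSyzygyOfOrder R M (j + 1)) :
    ∃ (n : ℕ) (g : M →ₗ[R] (Fin n → R)), Function.Injective g ∧
      IsSyzygyOfOrder R ((Fin n → R) ⧸ LinearMap.range g) j := by
  obtain ⟨n, g, f, hg, hgf, hf⟩ := h
  have hgf := hgf (by omega)
  have hle : LinearMap.range g ≤ LinearMap.ker (f 0) := (LinearMap.exact_iff.mp hgf).ge
  refine ⟨n 0, g, hg, fun i ↦ n (i + 1), (LinearMap.range g).liftQ (f 0) hle,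
    fun i ↦ f (i + 1), ?_, fun h2 ↦ ?_, fun i hi ↦ hf (i + 1) (by omega)⟩
  · rw [← LinearMap.ker_eq_bot]
    exact Submodule.ker_liftQ_eq_bot _ _ _ (LinearMap.exact_iff.mp hgf).le
  · rw [LinearMap.exact_iff, Submodule.range_liftQ]
    exact LinearMap.exact_iff.mp (hf 0 (by omega))

lemma isSyzygyOfOrder_one {M : Type*} [AddCommGroup M] [Module R M] {n : ℕ}
    (g : M →ₗ[R] (Fin n → R)) (hg : Function.Injective g) : IsSyzygyOfOrder R M 1 :=
  ⟨fun _ ↦ n, g, fun _ ↦ 0, hg, by omega, by omega⟩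

lemma IsSyzygyOfOrder.of_cokernel {M : Type*} [AddCommGroup M] [Module R M] {j : ℕ} {n : ℕ}
    (g : M →ₗ[R] (Fin n → R)) (hg : Function.Injective g)
    (h : IsSyzygyOfOrder R ((Fin n → R) ⧸ LinearMap.range g) j) :
    IsSyzygyOfOrder R M (j + 1) := by
  obtain ⟨m, g', f, hg', hgf, hf⟩ := h
  have hker : LinearMap.ker (g' ∘ₗ (LinearMap.range g).mkQ) = LinearMap.range g := by
    rw [LinearMap.ker_comp, LinearMap.ker_eq_bot.mpr hg', Submodule.comap_bot, Submodule.ker_mkQ]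
  refine ⟨fun | 0 => n | i + 1 => m i, g,
    fun | 0 => g' ∘ₗ (LinearMap.range g).mkQ | i + 1 => f i, hg, fun _ ↦ ?_, fun i hi ↦ ?_⟩
  · exact LinearMap.exact_iff.mpr hker
  · cases i with
    | zero =>
      rw [LinearMap.exact_iff]
      change LinearMap.ker (f 0) = LinearMap.range (g' ∘ₗ (LinearMap.range g).mkQ)
      rw [LinearMap.range_comp, Submodule.range_mkQ, Submodule.map_top]
      exact LinearMap.exact_iff.mp (hgf (by omega))
    | succ i => exact hf i (by omega)

lemma IsSyzygyOfOrder.of_linearEquiv {M N : Type*} [AddCommGroup M] [Module R M]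
    [AddCommGroup N] [Module R N] (e : M ≃ₗ[R] N) {j : ℕ} (h : IsSyzygyOfOrder R M j) :
    IsSyzygyOfOrder R N j := by
  obtain ⟨n, g, f, hg, hgf, hf⟩ := h
  refine ⟨n, g ∘ₗ e.symm.toLinearMap, f, hg.comp e.symm.injective, fun h2 ↦ ?_, hf⟩
  rw [LinearMap.exact_iff, LinearEquiv.range_comp]
  exact LinearMap.exact_iff.mp (hgf h2)

lemma IsRegularUpTo.succ_of_injective {S : Type*} [CommRing S] [Algebra R S]
    {M F : Type*} [AddCommGroup M] [Module R M] [Module S M] [IsScalarTower R S M]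
    [AddCommGroup F] [Module R F] [Module S F] [IsScalarTower R S F] [Module.Flat R F]
    (g : M →ₗ[S] F) (hg : Function.Injective g) {j : ℕ}
    (hN : IsRegularUpTo R (F ⧸ LinearMap.range g) j) : IsRegularUpTo R M (j + 1) := by
  let g' : M →ₗ[R] F := g.restrictScalars R
  let f' : F →ₗ[R] (F ⧸ LinearMap.range g) := (LinearMap.range g).mkQ.restrictScalars R
  have hg' : Function.Injective g' := hg
  have hgf : Function.Exact g' f' := LinearMap.exact_map_mkQ_range g
  have hf : Function.Surjective f' := Quotient.mk_surjective
  exact hN.succ_of_exact hg' hgf hf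

lemma IsSyzygyOfOrder.isRegularUpTo_aux {S : Type v} [CommRing S] [Algebra R S] [Module.Flat R S]
    {M : Type v} [AddCommGroup M] [Module R M] [Module S M] [IsScalarTower R S M] {j : ℕ}
    (hj : 1 ≤ j) (h : IsSyzygyOfOrder S M j) : IsRegularUpTo R M j := by
  induction j, hj using Nat.le_induction generalizing M with
  | base =>
    obtain ⟨n, g, -, hg, -⟩ := h
    have := Module.Flat.of_linearEquiv (DirectSum.linearEquivFunOnFintype R (Fin (n 0)) fun _ ↦ S).symm
    refine IsRegularUpTo.succ_of_injective g hg fun xs hxs _ ↦ ?_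
    rw [List.length_eq_zero_iff.mp (Nat.le_zero.mp hxs)]
    exact .nil R _
  | succ j hj ih =>
    obtain ⟨n, g, hg, hN⟩ := h.exists_cokernel hj
    have := Module.Flat.of_linearEquiv (DirectSum.linearEquivFunOnFintype R (Fin n) fun _ ↦ S).symm
    exact IsRegularUpTo.succ_of_injective g hg (ih hN)

/-- A higher syzygy over a flat algebra satisfies the regularity condition over the base. -/
lemma IsSyzygyOfOrder.isRegularUpTo {S : Type*} [CommRing S] [Algebra R S] [Module.Flat R S]
    {M : Type*} [AddCommGroup M] [Module R M] [Module S M] [IsScalarTower R S M] {j : ℕ}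
    (hj : 1 ≤ j) (h : IsSyzygyOfOrder S M j) : IsRegularUpTo R M j := by
  obtain ⟨n, g, -, hg, -⟩ := id h
  let e : M ≃ₗ[S] LinearMap.range g := LinearEquiv.ofInjective g hg
  exact (isRegularUpTo_aux hj (h.of_linearEquiv e)).of_retract
    (e.toLinearMap.restrictScalars R) (e.symm.toLinearMap.restrictScalars R) e.symm_apply_apply

/-- Higher syzygies are preserved by flat base change. -/
lemma IsSyzygyOfOrder.baseChange (S : Type*) [CommRing S] [Algebra R S] [Module.Flat R S]
    {M : Type*} [AddCommGroup M] [Module R M] {j : ℕ} (h : IsSyzygyOfOrder R M j) :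
    IsSyzygyOfOrder S (S ⊗[R] M) j := by
  obtain ⟨n, g, f, hg, hgf, hf⟩ := h
  let e (i : ℕ) : S ⊗[R] (Fin (n i) → R) ≃ₗ[S] (Fin (n i) → S) :=
    TensorProduct.piScalarRight R S S (Fin (n i))
  refine ⟨n, (e 0).toLinearMap ∘ₗ g.baseChange S,
    fun i ↦ (e (i + 1)).toLinearMap ∘ₗ (f i).baseChange S ∘ₗ (e i).symm.toLinearMap,
    (e 0).injective.comp (Module.Flat.lTensor_preserves_injective_linearMap g hg),
    fun h2 y ↦ ?_, fun i hi y ↦ ?_⟩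
  · have h : (f 0).baseChange S ((e 0).symm y) = 0 ↔
        ∃ x, g.baseChange S x = (e 0).symm y :=
      Module.Flat.lTensor_exact S (hgf h2) ((e 0).symm y)
    simpa [LinearEquiv.eq_symm_apply] using h
  · have h : (f (i + 1)).baseChange S ((e (i + 1)).symm y) = 0 ↔
        ∃ x, (f i).baseChange S x = (e (i + 1)).symm y :=
      Module.Flat.lTensor_exact S (hf i hi) ((e (i + 1)).symm y)
    rw [(e i).symm.surjective.exists] at h
    simpa [LinearEquiv.eq_symm_apply] using h

end Syzygy

section HilbertSyzygy

open CategoryTheory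

universe u

lemma ModuleCat.hasProjectiveDimensionLE_succ_iff {R M F N : Type u} [CommRing R]
    [AddCommGroup M] [Module R M] [AddCommGroup F] [Module R F] [Module.Projective R F]
    [AddCommGroup N] [Module R N] {g : M →ₗ[R] F} {f : F →ₗ[R] N} (hg : Function.Injective g)
    (hgf : Function.Exact g f) (hf : Function.Surjective f) (n : ℕ) :
    HasProjectiveDimensionLE (ModuleCat.of R N) (n + 1) ↔
      HasProjectiveDimensionLE (ModuleCat.of R M) n :=
  (ModuleCat.shortComplex_shortExact
    (ModuleCat.shortComplexOfCompEqZero g f hgf.linearMap_comp_eq_zero) hgf hg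
    hf).hasProjectiveDimensionLT_X₃_iff n
      ((IsProjective.iff_projective _).mp (inferInstanceAs (Module.Projective R F)))

lemma ModuleCat.hasProjectiveDimensionLE_zero_iff {R M : Type u} [CommRing R]
    [AddCommGroup M] [Module R M] :
    HasProjectiveDimensionLE (ModuleCat.of R M) 0 ↔ Module.Projective R M := by
  rw [← projective_iff_hasProjectiveDimensionLE_zero, ← IsProjective.iff_projective]

lemma ModuleCat.hasProjectiveDimensionLE_baseChange {R S : Type u} [CommRing R] [CommRing S]
    [Algebra R S] [Module.Flat R S] (n : ℕ) (M : Type u) [AddCommGroup M] [Module R M]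
    (h : HasProjectiveDimensionLE (ModuleCat.of R M) n) :
    HasProjectiveDimensionLE (ModuleCat.of S (S ⊗[R] M)) n := by
  induction n generalizing M with
  | zero =>
    rw [hasProjectiveDimensionLE_zero_iff] at h ⊢
    exact Module.Projective.tensorProduct
  | succ n ih =>
    obtain ⟨K, _, _, i, hi, hif⟩ : ∃ (K : Type u) (_ : AddCommGroup K) (_ : Module R K)
        (i : K →ₗ[R] (M →₀ R)), Function.Injective i ∧
        Function.Exact i (Finsupp.linearCombination R (id : M → M)) :=
      ⟨_, _, _, _, Submodule.injective_subtype _, LinearMap.exact_subtype_ker_map _⟩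
    have hf := Finsupp.linearCombination_id_surjective R M
    have hie : Function.Exact (i.baseChange S) ((Finsupp.linearCombination R id).baseChange S) :=
      Module.Flat.lTensor_exact S hif
    exact (hasProjectiveDimensionLE_succ_iff
      (Module.Flat.lTensor_preserves_injective_linearMap i hi) hie
      (LinearMap.lTensor_surjective S hf) n).mpr
        (ih _ ((hasProjectiveDimensionLE_succ_iff hi hif hf n).mp h))

section Polynomial

open Polynomial

variable {R M : Type*} [CommRing R] [AddCommGroup M] [Module R M] [Module R[X] M]
  [IsScalarTower R R[X] M]

/-- The `R[X]`-linear endomorphism `p ⊗ m ↦ X p ⊗ m - p ⊗ X m` of `R[X] ⊗ M`. -/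
noncomputable def tensorSubX (R M : Type*) [CommRing R] [AddCommGroup M] [Module R M]
    [Module R[X] M] [IsScalarTower R R[X] M] : R[X] ⊗[R] M →ₗ[R[X]] R[X] ⊗[R] M :=
  LinearMap.lsmul R[X] (R[X] ⊗[R] M) X - (Algebra.lsmul R R M (X : R[X])).baseChange R[X]

/-- The action map `p ⊗ m ↦ p m`. -/
noncomputable def tensorAction (R M : Type*) [CommRing R] [AddCommGroup M] [Module R M]
    [Module R[X] M] [IsScalarTower R R[X] M] : R[X] ⊗[R] M →ₗ[R[X]] M :=
  (LinearMap.id : M →ₗ[R] M).liftBaseChange R[X]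

/-- The contracting homotopy `X ^ n ⊗ m ↦ ∑ i + j = n - 1, X ^ i ⊗ X ^ j m`, as a function
of `m`. -/
noncomputable def tensorHomotopyAux (R M : Type*) [CommRing R] [AddCommGroup M] [Module R M]
    [Module R[X] M] [IsScalarTower R R[X] M] : ℕ → M →ₗ[R] R[X] ⊗[R] M
  | 0 => 0
  | n + 1 => TensorProduct.mk R R[X] M (X ^ n) +
      tensorHomotopyAux R M n ∘ₗ Algebra.lsmul R R M (X : R[X])

/-- The contracting homotopy `X ^ n ⊗ m ↦ ∑ i + j = n - 1, X ^ i ⊗ X ^ j m`. -/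
noncomputable def tensorHomotopy (R M : Type*) [CommRing R] [AddCommGroup M] [Module R M]
    [Module R[X] M] [IsScalarTower R R[X] M] : R[X] ⊗[R] M →ₗ[R] R[X] ⊗[R] M :=
  TensorProduct.lift ((Polynomial.basisMonomials R).constr R (tensorHomotopyAux R M))

lemma tensorHomotopy_X_pow_tmul (n : ℕ) (m : M) :
    tensorHomotopy R M ((X ^ n) ⊗ₜ m) = tensorHomotopyAux R M n m := by
  have h := (Polynomial.basisMonomials R).constr_basis R (tensorHomotopyAux R M) n
  rw [coe_basisMonomials] at h
  simp [tensorHomotopy, X_pow_eq_monomial, h]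

lemma tensorHomotopy_X_pow_succ_tmul (n : ℕ) (m : M) :
    tensorHomotopy R M ((X ^ (n + 1)) ⊗ₜ m) =
      (X ^ n) ⊗ₜ m + tensorHomotopy R M ((X ^ n) ⊗ₜ ((X : R[X]) • m)) := by
  simp [tensorHomotopy_X_pow_tmul, tensorHomotopyAux]

lemma tensorSubX_tmul (p : R[X]) (m : M) :
    tensorSubX R M (p ⊗ₜ m) = (X * p) ⊗ₜ m - p ⊗ₜ ((X : R[X]) • m) := by
  simp [tensorSubX, TensorProduct.smul_tmul']

lemma tensorAction_tmul (p : R[X]) (m : M) : tensorAction R M (p ⊗ₜ m) = p • m := by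
  simp [tensorAction]

lemma polynomialTensor_hom_ext {R M N : Type*} [CommRing R] [AddCommGroup M] [Module R M]
    [AddCommGroup N] [Module R N]
    {f g : R[X] ⊗[R] M →ₗ[R] N} (h : ∀ (n : ℕ) (m : M), f ((X ^ n) ⊗ₜ m) = g ((X ^ n) ⊗ₜ m)) :
    f = g := by
  refine TensorProduct.ext ((Polynomial.basisMonomials R).ext fun n ↦ LinearMap.ext fun m ↦ ?_)
  simpa [X_pow_eq_monomial] using h n m

lemma tensorHomotopy_comp_tensorSubX :
    tensorHomotopy R M ∘ₗ (tensorSubX R M).restrictScalars R = LinearMap.id := by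
  refine polynomialTensor_hom_ext fun n m ↦ ?_
  simp [tensorSubX_tmul, ← pow_succ', tensorHomotopy_X_pow_succ_tmul]

lemma tensorSubX_comp_tensorHomotopy :
    (tensorSubX R M).restrictScalars R ∘ₗ tensorHomotopy R M +
      TensorProduct.mk R R[X] M 1 ∘ₗ (tensorAction R M).restrictScalars R = LinearMap.id := by
  refine polynomialTensor_hom_ext fun n m ↦ ?_
  induction n generalizing m with
  | zero =>
    have h := tensorHomotopy_X_pow_tmul (R := R) 0 m
    rw [pow_zero, tensorHomotopyAux] at h
    simp [h, tensorAction_tmul]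
  | succ n ih =>
    have := ih ((X : R[X]) • m)
    simp [tensorHomotopy_X_pow_succ_tmul, tensorSubX_tmul, tensorAction_tmul, smul_smul,
      ← pow_succ, ← pow_succ'] at this ⊢
    rw [← sub_eq_zero] at this ⊢
    rw [← this]
    abel

lemma tensorSubX_injective : Function.Injective (tensorSubX R M) :=
  Function.LeftInverse.injective (g := tensorHomotopy R M)
    (LinearMap.congr_fun tensorHomotopy_comp_tensorSubX)

lemma tensorAction_surjective : Function.Surjective (tensorAction R M) :=
  fun m ↦ ⟨1 ⊗ₜ m, by simp [tensorAction_tmul]⟩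

lemma exact_tensorSubX_tensorAction : Function.Exact (tensorSubX R M) (tensorAction R M) := by
  intro t
  constructor
  · intro ht
    refine ⟨tensorHomotopy R M t, ?_⟩
    simpa [ht] using LinearMap.congr_fun (tensorSubX_comp_tensorHomotopy (R := R) (M := M)) t
  · rintro ⟨t, rfl⟩
    have h : (tensorAction R M ∘ₗ tensorSubX R M).restrictScalars R = 0 :=
      polynomialTensor_hom_ext fun n m ↦ by
        simp [tensorSubX_tmul, tensorAction_tmul, smul_smul, mul_comm]
    exact LinearMap.congr_fun h t

lemma Polynomial.hasProjectiveDimensionLE {R : Type u} [CommRing R] (n : ℕ)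
    (h : ∀ M : ModuleCat.{u} R, HasProjectiveDimensionLE M n) (M : ModuleCat.{u} R[X]) :
    HasProjectiveDimensionLE M (n + 1) := by
  let : Module R M := Module.compHom M (C : R →+* R[X])
  have : IsScalarTower R R[X] M := ⟨fun r p m ↦ by
    rw [Algebra.smul_def, mul_smul]
    rfl⟩
  have hT := ModuleCat.hasProjectiveDimensionLE_baseChange (S := R[X]) n M (h (ModuleCat.of R M))
  exact (ModuleCat.shortComplex_shortExact (ModuleCat.shortComplexOfCompEqZero
    (tensorSubX R M) (tensorAction R M)
    exact_tensorSubX_tensorAction.linearMap_comp_eq_zero) exact_tensorSubX_tensorAction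
      tensorSubX_injective tensorAction_surjective).hasProjectiveDimensionLT_X₃ (n + 1) hT
      (hasProjectiveDimensionLT_of_ge _ (n + 1) _ (by omega))

lemma hasProjectiveDimensionLE_of_ringEquiv {R R' : Type u} [CommRing R] [CommRing R']
    (e : R ≃+* R') (n : ℕ) (h : ∀ M : ModuleCat.{u} R, HasProjectiveDimensionLE M n)
    (M : ModuleCat.{u} R') : HasProjectiveDimensionLE M n := by
  let : Module R M := Module.compHom M e.toRingHom
  have := RingHomInvPair.of_ringEquiv e
  have := RingHomInvPair.of_ringEquiv e.symm
  let e' : ModuleCat.of R M ≃ₛₗ[RingHomClass.toRingHom e] M :=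
    { AddEquiv.refl M with map_smul' := fun _ _ ↦ rfl }
  have := h (ModuleCat.of R M)
  exact ModuleCat.hasProjectiveDimensionLE_of_semiLinearEquiv e e' n

/-- **Hilbert's syzygy theorem**: every module over a polynomial ring in `r` variables over a
field has projective dimension at most `r`. -/
theorem MvPolynomial.hasProjectiveDimensionLE (k : Type u) [Field k] (r : ℕ)
    (M : ModuleCat.{u} (MvPolynomial (Fin r) k)) : HasProjectiveDimensionLE M r := by
  induction r with
  | zero =>
    refine hasProjectiveDimensionLE_of_ringEquiv
      (MvPolynomial.isEmptyRingEquiv k (Fin 0)).symm 0 (fun N ↦ ?_) M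
    exact ModuleCat.hasProjectiveDimensionLE_zero_iff.mpr inferInstance
  | succ r ih =>
    exact hasProjectiveDimensionLE_of_ringEquiv
      (MvPolynomial.finSuccEquiv k r).symm.toRingEquiv _ (Polynomial.hasProjectiveDimensionLE r ih) M

end Polynomial

end HilbertSyzygy

section LocalFreeness

open RingTheory.Sequence IsLocalRing

lemma mem_maximalIdeal_smul_top_of_tmul_eq_zero {A M : Type*} [CommRing A] [IsLocalRing A]
    [AddCommGroup M] [Module A M] {m : M} :
    (1 : ResidueField A) ⊗ₜ[A] m = 0 ↔ m ∈ maximalIdeal A • (⊤ : Submodule A M) := by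
  rw [← Submodule.Quotient.mk_eq_zero, ← TensorProduct.quotTensorEquivQuotSMul_mk_one_tmul,
    LinearEquiv.map_eq_zero_iff]
  rfl

lemma residueField_tensor_exists {A M : Type*} [CommRing A] [IsLocalRing A]
    [AddCommGroup M] [Module A M] (t : ResidueField A ⊗[A] M) :
    ∃ m : M, (1 : ResidueField A) ⊗ₜ[A] m = t := by
  obtain ⟨m, hm⟩ := TensorProduct.mk_surjective A M (ResidueField A) residue_surjective t
  exact ⟨m, hm⟩

lemma Module.free_of_exact_of_socle {A : Type*} [CommRing A] [IsLocalRing A] {I : Ideal A} {σ : A}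
    (hσ : σ ∉ I) (hI : ∀ a ∈ maximalIdeal A, a * σ ∈ I)
    {K F N : Type*} [AddCommGroup K] [Module A K] [AddCommGroup F] [Module A F]
    [AddCommGroup N] [Module A N] [Module.Finite A K] [Module.Free A K]
    [Module.Finite A F] [Module.Free A F] {l : K →ₗ[A] F} {g : F →ₗ[A] N}
    (hg : Function.Surjective g) (hlg : Function.Exact l g)
    (h : ∀ v : K, l v ∈ I • (⊤ : Submodule A F) → v ∈ I • (⊤ : Submodule A K)) :
    Module.Free A N := by
  refine Module.free_of_lTensor_residueField_injective l g hg hlg ?_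
  rw [injective_iff_map_eq_zero]
  intro t ht
  obtain ⟨v, rfl⟩ := residueField_tensor_exists t
  rw [LinearMap.lTensor_tmul, mem_maximalIdeal_smul_top_of_tmul_eq_zero] at ht
  rw [mem_maximalIdeal_smul_top_of_tmul_eq_zero]
  have hle : ∀ x ∈ maximalIdeal A • (⊤ : Submodule A F), σ • x ∈ I • (⊤ : Submodule A F) := by
    intro x hx
    induction hx using Submodule.smul_induction_on' with
    | smul a ha y _ =>
      rw [smul_smul, mul_comm]
      exact Submodule.smul_mem_smul (hI a ha) trivial
    | add x _ y _ hx hy =>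
      rw [smul_add]
      exact add_mem hx hy
  have hv := h (σ • v) (by rw [map_smul]; exact hle _ ht)
  let b := Module.Free.chooseBasis A K
  rw [← b.sum_repr v]
  refine Submodule.sum_mem _ fun i _ ↦ Submodule.smul_mem_smul ?_ trivial
  rw [mem_maximalIdeal, mem_nonunits_iff]
  intro hu
  have hc : σ * b.repr v i ∈ I := by
    have h := (b.coord i).map_mem_smul_top hv
    simpa using h
  exact hσ ((I.mul_unit_mem_iff_mem hu).mp hc)

universe u

lemma Module.free_of_hasProjectiveDimensionLE_of_isWeaklyRegular {A : Type u} [CommRing A]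
    [IsLocalRing A] [IsNoetherianRing A] {xs : List A} (hA : IsWeaklyRegular A xs) {σ : A}
    (hσ : σ ∉ Ideal.ofList xs) (hI : ∀ a ∈ maximalIdeal A, a * σ ∈ Ideal.ofList xs) (n : ℕ)
    (M : Type u) [AddCommGroup M] [Module A M] [Module.Finite A M]
    (hM : IsWeaklyRegular M xs)
    (h : CategoryTheory.HasProjectiveDimensionLE (ModuleCat.of A M) n) : Module.Free A M := by
  induction n generalizing M with
  | zero =>
    have := ModuleCat.hasProjectiveDimensionLE_zero_iff.mp h
    exact Module.free_of_flat_of_isLocalRing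
  | succ n ih =>
    obtain ⟨F, _, _, _, _, f, hf⟩ := Module.exists_finite_presentation A M
    have : Module.Finite A (LinearMap.ker f) := inferInstance
    obtain ⟨K, _, _, _, i, hi, hif⟩ : ∃ (K : Type u) (_ : AddCommGroup K) (_ : Module A K)
        (_ : Module.Finite A K) (i : K →ₗ[A] F), Function.Injective i ∧ Function.Exact i f :=
      ⟨_, _, _, this, _, Submodule.injective_subtype _, LinearMap.exact_subtype_ker_map _⟩
    have := ih K (isWeaklyRegular_of_exact hi hif hf (isWeaklyRegular_of_flat hA) hM)
      ((ModuleCat.hasProjectiveDimensionLE_succ_iff hi hif hf n).mp h)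
    exact Module.free_of_exact_of_socle hσ hI hf hif fun v hv ↦
      mem_smul_top_of_exact hi hif hf hM hv

end LocalFreeness

section Reflexivity

open RingTheory.Sequence

universe u

lemma exists_isPrime_of_forall_exists_mul_mem {R : Type*} [CommRing R] [IsNoetherianRing R]
    {I J : Ideal R} (h : ∀ y ∈ J, ∃ a ∉ I, y * a ∈ I) :
    ∃ (q : Ideal R) (_ : q.IsPrime) (σ : R), J ≤ q ∧ ∀ a, a ∈ q ↔ a * σ ∈ I := by
  have hJ : (J : Set R) ⊆ ⋃ p ∈ associatedPrimes R (R ⧸ I), (p : Set R) := by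
    rw [biUnion_associatedPrimes_eq_zero_divisors]
    intro y hy
    obtain ⟨a, ha, hya⟩ := h y hy
    refine ⟨Ideal.Quotient.mk I a, by rwa [Ne, Ideal.Quotient.eq_zero_iff_mem], ?_⟩
    exact Ideal.Quotient.eq_zero_iff_mem.mpr hya
  obtain ⟨q, hq, hJq⟩ := (Ideal.subset_union_prime_finite
    (associatedPrimes.finite R (R ⧸ I)) (f := id) 0 0 fun _ h _ _ ↦ h.1).mp hJ
  obtain ⟨hqp, x, hx⟩ := isAssociatedPrime_iff.mp hq
  obtain ⟨σ, rfl⟩ := Ideal.Quotient.mk_surjective x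
  refine ⟨q, hqp, σ, hJq, fun a ↦ ?_⟩
  rw [hx, Submodule.mem_colon_singleton, Submodule.mem_bot, ← Ideal.Quotient.eq_zero_iff_mem]
  rfl

lemma LocalizedModule.projective_of_hasProjectiveDimensionLE {R : Type u} [CommRing R]
    [IsNoetherianRing R] {xs : List R} (hR : IsWeaklyRegular R xs) {q : Ideal R} [q.IsPrime]
    {σ : R} (hσ : ∀ a, a ∈ q ↔ a * σ ∈ Ideal.ofList xs) {n : ℕ} (M : Type u) [AddCommGroup M]
    [Module R M] [Module.Finite R M] (hM : IsWeaklyRegular M xs)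
    (h : CategoryTheory.HasProjectiveDimensionLE (ModuleCat.of R M) n) :
    Module.Projective (Localization.AtPrime q) (LocalizedModule q.primeCompl M) := by
  let A := Localization.AtPrime q
  have hb := IsLocalizedModule.isBaseChange q.primeCompl A
    (LocalizedModule.mkLinearMap q.primeCompl M)
  have : Module.Free A (A ⊗[R] M) := by
    have : Module.Flat R A := IsLocalization.flat A q.primeCompl
    have : IsNoetherianRing A := IsLocalization.isNoetherianRing q.primeCompl A inferInstance
    refine Module.free_of_hasProjectiveDimensionLE_of_isWeaklyRegular (σ := algebraMap R A σ)
      (hR.of_isLocalization A q.primeCompl) ?_ ?_ n _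
      (hM.of_flat_of_isBaseChange (TensorProduct.isBaseChange R M A))
      (ModuleCat.hasProjectiveDimensionLE_baseChange n M h)
    · rw [← Ideal.map_ofList, IsLocalization.algebraMap_mem_map_algebraMap_iff q.primeCompl]
      rintro ⟨t, ht, hts⟩
      exact ht ((hσ t).mpr hts)
    · intro a ha
      obtain ⟨a, t, rfl⟩ := IsLocalization.exists_mk'_eq q.primeCompl a
      rw [IsLocalization.AtPrime.mk'_mem_maximal_iff A q] at ha
      rw [← Ideal.map_ofList, IsLocalization.mk'_eq_mul_mk'_one, mul_right_comm, ← map_mul]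
      exact Ideal.mul_mem_right _ _ (Ideal.mem_map_of_mem _ ((hσ a).mp ha))
  exact Module.Projective.of_equiv (M := A ⊗[R] M) hb.equiv

lemma exists_comp_eq_smul_of_projective_localizedModule {R M : Type*} [CommRing R]
    [IsNoetherianRing R] [AddCommGroup M] [Module R M] [Module.Finite R M] (S : Submonoid R)
    [Module.Projective (Localization S) (LocalizedModule S M)] :
    ∃ (a : ℕ) (h : M →ₗ[R] (Fin a → R)) (p : (Fin a → R) →ₗ[R] M) (s : S),
      ∀ m, p (h m) = s • m := by
  obtain ⟨a, p, hp⟩ := Module.Finite.exists_fin' R M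
  have : Module.FinitePresentation R M := Module.finitePresentation_of_finite R M
  let fF := LocalizedModule.mkLinearMap S (Fin a → R)
  let fM := LocalizedModule.mkLinearMap S M
  obtain ⟨τ, hτ⟩ := Module.projective_lifting_property (LocalizedModule.map S p) LinearMap.id
    (LocalizedModule.map_surjective S p hp)
  obtain ⟨h, s, hs⟩ := Module.FinitePresentation.exists_lift_of_isLocalizedModule S fF
    (τ.restrictScalars R ∘ₗ fM)
  have hc : fM ∘ₗ (p ∘ₗ h) = fM ∘ₗ (s • LinearMap.id) := by
    ext m
    have h1 := LinearMap.congr_fun hs m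
    have h2 := LinearMap.congr_fun hτ (fM m)
    have h3 : fM (p (h m)) = LocalizedModule.map S p (fF (h m)) := by
      simp [fM, fF]
    have h4 : fM (p (h m)) = (s : R) • fM m := by
      rw [h3, show fF (h m) = (s : R) • τ (fM m) from h1, LinearMap.map_smul_of_tower]
      exact congrArg _ h2
    simpa [Submonoid.smul_def] using h4
  obtain ⟨s', hs'⟩ := Module.Finite.exists_smul_of_comp_eq_of_isLocalizedModule S fM _ _ hc
  refine ⟨a, s' • h, p, s' * s, fun m ↦ ?_⟩
  have := LinearMap.congr_fun hs' m
  simpa [mul_smul] using this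

end Reflexivity

section Embedding

open RingTheory.Sequence CategoryTheory

universe u

lemma exists_linearMap_factoring {R M : Type*} [CommRing R] [IsNoetherianRing R]
    [AddCommGroup M] [Module R M] [Module.Finite R M] :
    ∃ (n : ℕ) (g : M →ₗ[R] (Fin n → R)), ∀ (a : ℕ) (h : M →ₗ[R] (Fin a → R)),
      ∃ t : (Fin n → R) →ₗ[R] (Fin a → R), t ∘ₗ g = h := by
  obtain ⟨n, s, hs⟩ := Module.Finite.exists_fin (R := R) (M := Module.Dual R M)
  refine ⟨n, LinearMap.pi s, fun a h ↦ ?_⟩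
  have hc (i : Fin a) : ∃ c : Fin n → R, ∑ j, c j • s j = LinearMap.proj i ∘ₗ h := by
    rw [← Submodule.mem_span_range_iff_exists_fun, hs]
    trivial
  choose c hc using hc
  refine ⟨LinearMap.pi fun i ↦ ∑ j, c i j • LinearMap.proj j, ?_⟩
  ext m i
  simpa using LinearMap.congr_fun (hc i) m

variable {R : Type u} [CommRing R] [IsNoetherianRing R] {d : ℕ}
  (hR : ∀ M : ModuleCat.{u} R, HasProjectiveDimensionLE M d)
include hR

lemma IsRegularUpTo.mem_smul_top_of_map_mem {M : Type u} [AddCommGroup M] [Module R M]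
    [Module.Finite R M] {j n : ℕ} (hM : IsRegularUpTo R M (j + 1)) {g : M →ₗ[R] (Fin n → R)}
    (hg : ∀ (a : ℕ) (h : M →ₗ[R] (Fin a → R)),
      ∃ t : (Fin n → R) →ₗ[R] (Fin a → R), t ∘ₗ g = h)
    {xs : List R} (hxs : xs.length ≤ j) (hreg : IsWeaklyRegular R xs) {m : M}
    (hm : g m ∈ Ideal.ofList xs • (⊤ : Submodule R (Fin n → R))) :
    m ∈ Ideal.ofList xs • (⊤ : Submodule R M) := by
  by_contra hmem
  let J : Ideal R := (Ideal.ofList xs • (⊤ : Submodule R M)).comap (LinearMap.toSpanSingleton R M m)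
  have hJ : ∀ y ∈ J, ∃ a ∉ Ideal.ofList xs, y * a ∈ Ideal.ofList xs := by
    intro y hy
    by_contra! hy'
    have h := hM (xs ++ [y]) (by simpa using hxs) ((isWeaklyRegular_concat_iff _ _).mpr
      ⟨hreg, fun a ha ↦ by
        by_contra h
        simp only [smul_eq_mul, Ideal.mul_top] at ha h
        exact hy' a h ha⟩)
    exact hmem (((isWeaklyRegular_concat_iff _ _).mp h).2 m hy)
  obtain ⟨q, _, σ, hJq, hσ⟩ := exists_isPrime_of_forall_exists_mul_mem hJ
  have := LocalizedModule.projective_of_hasProjectiveDimensionLE hreg hσ M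
    (hM xs (by omega) hreg) (hR (ModuleCat.of R M))
  obtain ⟨a, h, p, s, hs⟩ := exists_comp_eq_smul_of_projective_localizedModule (M := M) q.primeCompl
  obtain ⟨t, rfl⟩ := hg a h
  refine s.2 (hJq ?_)
  have hpt := p.map_mem_smul_top (t.map_mem_smul_top hm)
  rw [show p (t (g m)) = s • m from hs m] at hpt
  exact hpt

lemma IsRegularUpTo.exists_embedding {M : Type u} [AddCommGroup M] [Module R M]
    [Module.Finite R M] {j : ℕ} (hM : IsRegularUpTo R M (j + 1)) :
    ∃ (n : ℕ) (g : M →ₗ[R] (Fin n → R)), Function.Injective g ∧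
      IsRegularUpTo R ((Fin n → R) ⧸ LinearMap.range g) j := by
  obtain ⟨n, g, hg⟩ := exists_linearMap_factoring (R := R) (M := M)
  refine ⟨n, g, (injective_iff_map_eq_zero g).mpr fun m hm ↦ ?_, fun xs hxs hreg ↦ ?_⟩
  · simpa using hM.mem_smul_top_of_map_mem hR hg (xs := []) (Nat.zero_le _) (.nil R R)
      (m := m) (by simpa using hm)
  · refine isWeaklyRegular_cokernel (LinearMap.exact_map_mkQ_range g) (Submodule.mkQ_surjective _)
      (isWeaklyRegular_of_flat hreg) fun ys hys m hm ↦ ?_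
    obtain ⟨zs, rfl⟩ := hys
    refine hM.mem_smul_top_of_map_mem hR hg (le_trans (by simp) hxs) ?_ hm
    exact ((isWeaklyRegular_append_iff _ _ _).mp hreg).1

lemma IsRegularUpTo.isSyzygyOfOrder {M : Type u} [AddCommGroup M] [Module R M]
    [Module.Finite R M] {j : ℕ} (hj : 1 ≤ j) (hM : IsRegularUpTo R M j) :
    IsSyzygyOfOrder R M j := by
  induction j, hj using Nat.le_induction generalizing M with
  | base =>
    obtain ⟨n, g, hg, -⟩ := hM.exists_embedding hR
    exact isSyzygyOfOrder_one g hg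
  | succ j hj ih =>
    obtain ⟨n, g, hg, hN⟩ := hM.exists_embedding hR
    exact IsSyzygyOfOrder.of_cokernel g hg (ih hN)

end Embedding

section Retract

variable {R : Type*} [CommRing R]

/-- A module is a direct summand of its base change to a nontrivial free algebra. -/
lemma IsRegularUpTo.of_baseChange (S : Type*) [CommRing S] [Algebra R S] [Module.Free R S]
    [Nontrivial S] {M : Type*} [AddCommGroup M] [Module R M] {j : ℕ}
    (h : IsRegularUpTo R (S ⊗[R] M) j) : IsRegularUpTo R M j := by
  let b := Module.Free.chooseBasis R S
  have hb := b.index_nonempty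
  let i := hb.some
  exact h.of_retract (TensorProduct.mk R S M (b i))
    ((TensorProduct.lid R M).toLinearMap ∘ₗ (b.coord i).rTensor M) fun m ↦ by simp

end Retract

/-- Let `k` be a field, `R = k[x₁,…,x_r]` a polynomial ring, and `S` a commutative
`R`-algebra that is free of finite positive rank as an `R`-module.  For a finitely
generated `R`-module `B` and `j ≥ 1`, the `S`-module `B ⊗_R S` is a `j`-th syzygy over
`S` iff `B` is a `j`-th syzygy over `R`. -/
theorem syzygy_baseChange_iff (k : Type*) [Field k] (r : ℕ)
    (S : Type*) [CommRing S] [Algebra (MvPolynomial (Fin r) k) S]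
    [Module.Free (MvPolynomial (Fin r) k) S] [Module.Finite (MvPolynomial (Fin r) k) S]
    (hrank : 0 < Module.rank (MvPolynomial (Fin r) k) S)
    (B : Type*) [AddCommGroup B] [Module (MvPolynomial (Fin r) k) B]
    [Module.Finite (MvPolynomial (Fin r) k) B]
    (j : ℕ) (hj : 1 ≤ j) :
    IsSyzygyOfOrder S (S ⊗[MvPolynomial (Fin r) k] B) j ↔
      IsSyzygyOfOrder (MvPolynomial (Fin r) k) B j := by
  have hS : Nontrivial S := by
    by_contra hS
    rw [not_nontrivial_iff_subsingleton] at hS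
    simp at hrank
  refine ⟨fun h ↦ ?_, fun h ↦ h.baseChange S⟩
  have hB := (h.isRegularUpTo (R := MvPolynomial (Fin r) k) hj).of_baseChange S
  obtain ⟨n, f, hf⟩ := Module.Finite.exists_fin' (MvPolynomial (Fin r) k) B
  let e := f.quotKerEquivOfSurjective hf
  exact ((hB.of_retract e.toLinearMap e.symm.toLinearMap e.symm_apply_apply).isSyzygyOfOrder
    (MvPolynomial.hasProjectiveDimensionLE k r) hj).of_linearEquiv e
end

section
/- Let n ≥ 1 and let R = 𝔽₂[t₁,…,tₙ,w] be the polynomial ring in n+1 variables over the field 𝔽₂ with two elements. Then the n+1 elements y₁ = t₁² + t₁w, …, yₙ = tₙ² + tₙw, and w are algebraically independent over 𝔽₂; consequently the 𝔽₂-subalgebra of R they generate is itself a polynomial ring in n+1 variables. -/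
open MvPolynomial

theorem MvPolynomial.isIntegral_of_isIntegral_X {σ R : Type*} [CommRing R]
    (S : Subalgebra R (MvPolynomial σ R))
    (h : ∀ i, IsIntegral S (X i : MvPolynomial σ R)) :
    Algebra.IsIntegral S (MvPolynomial σ R) := by
  refine ⟨fun p => ?_⟩
  induction p using MvPolynomial.induction_on with
  | C a => exact isIntegral_algebraMap (R := S) (x := algebraMap R S a)
  | add p q hp hq => exact hp.add hq
  | mul_X p i hp => exact hp.mul (h i)

theorem isIntegral_of_sq_add_mul_mem {R A : Type*} [CommRing R] [CommRing A] [Algebra R A]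
    (S : Subalgebra R A) {t w : A} (hw : w ∈ S) (ht : t ^ 2 + t * w ∈ S) :
    IsIntegral S t := by
  refine ⟨Polynomial.X ^ 2 + (Polynomial.C ⟨w, hw⟩ * Polynomial.X
    - Polynomial.C ⟨t ^ 2 + t * w, ht⟩), ?_, ?_⟩
  · nontriviality S
    refine Polynomial.monic_X_pow_add (lt_of_le_of_lt (b := 1) ?_ (by norm_num))
    compute_degree
  · simp
    ring

/-- In `R = 𝔽₂[t₁,…,tₙ,w]` (with `tᵢ = X i.castSucc`, `w = X (Fin.last n)`), the
`n + 1` elements `y₁ = t₁² + t₁w, …, yₙ = tₙ² + tₙw, w` are algebraically independent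
over `𝔽₂`; consequently the `𝔽₂`-subalgebra they generate is itself a polynomial ring
in `n + 1` variables. -/
theorem algebraicIndependent_y_w (n : ℕ) (hn : 1 ≤ n)
    (f : Fin (n + 1) → MvPolynomial (Fin (n + 1)) (ZMod 2))
    (hf : f = Fin.lastCases (X (Fin.last n))
      fun i : Fin n => X i.castSucc ^ 2 + X i.castSucc * X (Fin.last n)) :
    AlgebraicIndependent (ZMod 2) f ∧
      Nonempty (MvPolynomial (Fin (n + 1)) (ZMod 2) ≃ₐ[ZMod 2]
        Algebra.adjoin (ZMod 2) (Set.range f)) := by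
  have hmem (i) : f i ∈ Algebra.adjoin (ZMod 2) (Set.range f) :=
    Algebra.subset_adjoin ⟨i, rfl⟩
  have hw : (X (Fin.last n) : MvPolynomial (Fin (n + 1)) (ZMod 2)) ∈
      Algebra.adjoin (ZMod 2) (Set.range f) := by
    simpa [hf] using hmem (Fin.last n)
  have hy (i : Fin n) : (X i.castSucc ^ 2 + X i.castSucc * X (Fin.last n) :
      MvPolynomial (Fin (n + 1)) (ZMod 2)) ∈ Algebra.adjoin (ZMod 2) (Set.range f) := by
    simpa [hf] using hmem i.castSucc
  have hint : Algebra.IsIntegral (Algebra.adjoin (ZMod 2) (Set.range f))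
      (MvPolynomial (Fin (n + 1)) (ZMod 2)) := by
    refine MvPolynomial.isIntegral_of_isIntegral_X _ fun i => ?_
    induction i using Fin.lastCases with
    | last => exact isIntegral_algebraMap (x := (⟨_, hw⟩ : Algebra.adjoin _ (Set.range f)))
    | cast i => exact isIntegral_of_sq_add_mul_mem _ hw (hy i)
  have hind : AlgebraicIndependent (ZMod 2) f :=
    (Algebra.IsAlgebraic.isTranscendenceBasis_of_lift_le_trdeg_of_finite (ZMod 2) f
      (by simp [MvPolynomial.trdeg_of_isDomain])).1
  exact ⟨hind, ⟨hind.aevalEquiv⟩⟩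
end

section
/- Let n ≥ 1 and let R = 𝔽₂[t₁,…,tₙ,w] be the polynomial ring in n+1 variables over the field 𝔽₂ with two elements. For each i ∈ {1,…,n}, let φᵢ : R → R be the 𝔽₂-algebra homomorphism determined by φᵢ(tᵢ) = tᵢ + w, φᵢ(t_j) = t_j for j ≠ i, and φᵢ(w) = w. Then a polynomial p ∈ R satisfies φᵢ(p) = p for all i = 1,…,n if and only if p belongs to the 𝔽₂-subalgebra of R generated by the elements y₁ = t₁² + t₁w, …, yₙ = tₙ² + tₙw, and w. In other words, the ring of invariants of R under the group generated by φ₁,…,φₙ is exactly 𝔽₂[y₁,…,yₙ,w]. -/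
open MvPolynomial

/-- If `t` is a root of a monic quadratic over a subalgebra `A`, then every element of an algebra
generated by `t` and elements of `A` has the form `a + b * t` with `a, b ∈ A`. -/
theorem exists_eq_add_mul_of_mem_adjoin {k B : Type*} [CommRing k] [CommRing B] [Algebra k B]
    (A : Subalgebra k B) {t c d : B} (hc : c ∈ A) (hd : d ∈ A) (ht : t ^ 2 = c + d * t)
    {S : Set B} (hS : ∀ x ∈ S, x ∈ A ∨ x = t) {p : B} (hp : p ∈ Algebra.adjoin k S) :
    ∃ a ∈ A, ∃ b ∈ A, p = a + b * t := by
  induction hp using Algebra.adjoin_induction with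
  | mem x hx =>
    rcases hS x hx with h | rfl
    · exact ⟨x, h, 0, A.zero_mem, by ring⟩
    · exact ⟨0, A.zero_mem, 1, A.one_mem, by ring⟩
  | algebraMap r => exact ⟨_, A.algebraMap_mem r, 0, A.zero_mem, by ring⟩
  | add x y _ _ hx hy =>
    obtain ⟨a, ha, b, hb, rfl⟩ := hx
    obtain ⟨a', ha', b', hb', rfl⟩ := hy
    exact ⟨a + a', A.add_mem ha ha', b + b', A.add_mem hb hb', by ring⟩
  | mul x y _ _ hx hy =>
    obtain ⟨a, ha, b, hb, rfl⟩ := hx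
    obtain ⟨a', ha', b', hb', rfl⟩ := hy
    refine ⟨a * a' + b * b' * c, A.add_mem (A.mul_mem ha ha') (A.mul_mem (A.mul_mem hb hb') hc),
      a * b' + b * a' + b * b' * d,
      A.add_mem (A.add_mem (A.mul_mem ha hb') (A.mul_mem hb ha')) (A.mul_mem (A.mul_mem hb hb') hd),
      ?_⟩
    linear_combination b * b' * ht

/-- An algebra endomorphism fixing a generating set fixes the generated subalgebra. -/
theorem AlgHom.apply_eq_self_of_mem_adjoin {k B : Type*} [CommSemiring k] [Semiring B] [Algebra k B]
    (f : B →ₐ[k] B) {S : Set B} (hS : ∀ x ∈ S, f x = x) {p : B} (hp : p ∈ Algebra.adjoin k S) :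
    f p = p :=
  Algebra.adjoin_le (S := AlgHom.equalizer f (AlgHom.id k B)) hS hp

/-- The generators `w`, `tᵢ² + tᵢ w` for `i ∈ s`, and `tⱼ` for `j ∉ s`. -/
def partialGenerators (n : ℕ) (s : Finset (Fin n)) : Set (MvPolynomial (Fin (n + 1)) (ZMod 2)) :=
  {X (Fin.last n)} ∪ Set.range fun i : Fin n =>
    if i ∈ s then X i.castSucc ^ 2 + X i.castSucc * X (Fin.last n) else X i.castSucc

theorem adjoin_partialGenerators_empty (n : ℕ) :
    Algebra.adjoin (ZMod 2) (partialGenerators n ∅) = ⊤ := by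
  rw [eq_top_iff, ← MvPolynomial.adjoin_range_X]
  refine Algebra.adjoin_mono ?_
  rintro _ ⟨j, rfl⟩
  induction j using Fin.lastCases with
  | last => exact Or.inl rfl
  | cast j => exact Or.inr ⟨j, by simp⟩

/-- Let `R = 𝔽₂[t₁,…,tₙ,w]` (with `tᵢ = X i.castSucc`, `w = X (Fin.last n)`) and let
`φᵢ` be the `𝔽₂`-algebra endomorphism of `R` determined by `tᵢ ↦ tᵢ + w`, `t_j ↦ t_j`
for `j ≠ i` and `w ↦ w`.  Then `p ∈ R` is fixed by every `φᵢ` iff `p` lies in the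
`𝔽₂`-subalgebra generated by `y₁ = t₁² + t₁w, …, yₙ = tₙ² + tₙw` and `w`; i.e. the
invariant ring of the group generated by the `φᵢ` is exactly `𝔽₂[y₁,…,yₙ,w]`. -/
theorem invariants_eq_adjoin_y_w (n : ℕ) (hn : 1 ≤ n)
    (φ : Fin n →
      (MvPolynomial (Fin (n + 1)) (ZMod 2) →ₐ[ZMod 2] MvPolynomial (Fin (n + 1)) (ZMod 2)))
    (hφw : ∀ i, φ i (X (Fin.last n)) = X (Fin.last n))
    (hφt : ∀ i, φ i (X i.castSucc) = X i.castSucc + X (Fin.last n))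
    (hφt' : ∀ i j : Fin n, j ≠ i → φ i (X j.castSucc) = X j.castSucc)
    (p : MvPolynomial (Fin (n + 1)) (ZMod 2)) :
    (∀ i, φ i p = p) ↔
      p ∈ Algebra.adjoin (ZMod 2)
        (({X (Fin.last n)} ∪
            Set.range fun i : Fin n =>
              X i.castSucc ^ 2 + X i.castSucc * X (Fin.last n)) :
          Set (MvPolynomial (Fin (n + 1)) (ZMod 2))) := by
  have two : (2 : MvPolynomial (Fin (n + 1)) (ZMod 2)) = 0 := CharTwo.two_eq_zero
  have hy : ∀ i j : Fin n, φ i (X j.castSucc ^ 2 + X j.castSucc * X (Fin.last n)) =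
      X j.castSucc ^ 2 + X j.castSucc * X (Fin.last n) := by
    intro i j
    rw [map_add, map_pow, map_mul, hφw]
    by_cases hij : j = i
    · subst hij
      rw [hφt]
      linear_combination
        (X j.castSucc * X (Fin.last n) + X (Fin.last n) ^ 2) * two
    · rw [hφt' i j hij]
  have hfinal : ({X (Fin.last n)} ∪
      Set.range fun i : Fin n => X i.castSucc ^ 2 + X i.castSucc * X (Fin.last n) :
        Set (MvPolynomial (Fin (n + 1)) (ZMod 2))) = partialGenerators n Finset.univ := by
    simp [partialGenerators]
  constructor
  · intro hp
    rw [hfinal]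
    have key : ∀ s : Finset (Fin n), p ∈ Algebra.adjoin (ZMod 2) (partialGenerators n s) := by
      intro s
      induction s using Finset.induction_on with
      | empty => rw [adjoin_partialGenerators_empty]; trivial
      | insert i s his ih =>
        have hw : X (Fin.last n) ∈
            Algebra.adjoin (ZMod 2) (partialGenerators n (insert i s)) :=
          Algebra.subset_adjoin (Or.inl rfl)
        have hyi : X i.castSucc ^ 2 + X i.castSucc * X (Fin.last n) ∈
            Algebra.adjoin (ZMod 2) (partialGenerators n (insert i s)) :=
          Algebra.subset_adjoin (Or.inr ⟨i, by simp⟩)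
        have hfix : ∀ x ∈ partialGenerators n (insert i s), φ i x = x := by
          rintro _ (rfl | ⟨j, rfl⟩)
          · exact hφw i
          · by_cases hj : j ∈ insert i s
            · simpa only [if_pos hj] using hy i j
            · simpa only [if_neg hj] using
                hφt' i j fun h => hj (h ▸ Finset.mem_insert_self i s)
        have hgen : ∀ x ∈ partialGenerators n s,
            x ∈ Algebra.adjoin (ZMod 2) (partialGenerators n (insert i s)) ∨
              x = X i.castSucc := by
          rintro _ (rfl | ⟨j, rfl⟩)
          · exact Or.inl hw
          · by_cases hij : j = i
            · subst hij
              exact Or.inr (if_neg his)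
            · exact Or.inl (Algebra.subset_adjoin (Or.inr ⟨j, by simp [hij]⟩))
        obtain ⟨a, ha, b, hb, hab⟩ := exists_eq_add_mul_of_mem_adjoin _ hyi hw
          (t := X i.castSucc)
          (by linear_combination -(X i.castSucc * X (Fin.last n)) * two) hgen ih
        have hpi := hp i
        rw [hab, map_add, map_mul, hφt, (φ i).apply_eq_self_of_mem_adjoin hfix ha,
          (φ i).apply_eq_self_of_mem_adjoin hfix hb] at hpi
        have hbw : b * X (Fin.last n) = 0 := by linear_combination hpi
        have hb0 : b = 0 := (mul_eq_zero.mp hbw).resolve_right (X_ne_zero _)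
        rw [hab, hb0, zero_mul, add_zero]
        exact ha
    exact key Finset.univ
  · intro hp i
    refine (φ i).apply_eq_self_of_mem_adjoin ?_ hp
    rintro _ (rfl | ⟨j, rfl⟩)
    · exact hφw i
    · exact hy i j
end
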